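/- Let |ψ⟩ be a fully entangled stabilizer state on n ≥ 3 qubits such that for every M ∈ 𝒮(ψ) whose support is not a minimal support, there exists a minimal support ω′ of 𝒮(ψ) strictly contained in supp(M) with A_{ω′}(ψ) = 3. Then LU(ψ) = LC(ψ). -/

import Mathlib

open Matrix

noncomputable section

/-- Pauli matrices: `0 ↦ σ₀` (identity), `1 ↦ σₓ`, `2 ↦ σ_y`, `3 ↦ σ_z`. -/
def pauliMat : Fin 4 → Matrix (Fin 2) (Fin 2) ℂ :=
  ![1, !![0, 1; 1, 0], !![0, -Complex.I; Complex.I, 0], !![1, 0; 0, -1]]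

/-- Tensor (Kronecker) product of a family of one-qubit operators, as an operator
on qubits indexed by `ι`. -/
def kron {ι : Type} [Fintype ι] (U : ι → Matrix (Fin 2) (Fin 2) ℂ) :
    Matrix (ι → Fin 2) (ι → Fin 2) ℂ :=
  Matrix.of fun x y => ∏ i, U i (x i) (y i)

/-- An element of the Pauli group: a phase in `{1, -1, i, -i}` together with a
Pauli label (`σ₀, σₓ, σ_y, σ_z`) on every qubit. -/
structure PauliOp (ι : Type) where
  phase : ℂ
  label : ι → Fin 4
  phase_ok : phase = 1 ∨ phase = -1 ∨ phase = Complex.I ∨ phase = -Complex.I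

noncomputable instance {ι : Type} : DecidableEq (PauliOp ι) := Classical.decEq _

/-- The matrix of a Pauli group element. -/
def PauliOp.toMatrix {ι : Type} [Fintype ι] (M : PauliOp ι) :
    Matrix (ι → Fin 2) (ι → Fin 2) ℂ :=
  M.phase • kron fun i => pauliMat (M.label i)

/-- The support of a Pauli operator: the set of qubits on which it acts nontrivially. -/
def PauliOp.support {ι : Type} [Fintype ι] [DecidableEq ι] (M : PauliOp ι) : Finset ι :=
  Finset.univ.filter fun i => M.label i ≠ 0

/-- A (maximal) stabilizer on the qubits indexed by `ι`: an abelian subgroup of the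
Pauli group of cardinality `2^|ι|` which does not contain `-I`. -/
structure Stabilizer (ι : Type) [Fintype ι] [DecidableEq ι] where
  elems : Finset (PauliOp ι)
  one_mem : ∃ M ∈ elems, PauliOp.toMatrix M = 1
  mul_mem : ∀ M ∈ elems, ∀ N ∈ elems, ∃ K ∈ elems,
    PauliOp.toMatrix K = PauliOp.toMatrix M * PauliOp.toMatrix N
  comm : ∀ M ∈ elems, ∀ N ∈ elems,
    PauliOp.toMatrix M * PauliOp.toMatrix N = PauliOp.toMatrix N * PauliOp.toMatrix M
  neg_one_not_mem : ∀ M ∈ elems, PauliOp.toMatrix M ≠ -1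
  card_elems : elems.card = 2 ^ Fintype.card ι

variable {ι : Type} [Fintype ι] [DecidableEq ι]

/-- `ψ` is the stabilizer state of the stabilizer `S`: it is a unit vector fixed by
every element of `S`. -/
def stabilizesState (S : Stabilizer ι) (ψ : (ι → Fin 2) → ℂ) : Prop :=
  (∑ x, Complex.normSq (ψ x)) = 1 ∧ ∀ M ∈ S.elems, (PauliOp.toMatrix M).mulVec ψ = ψ

/-- `ψ` is a stabilizer state. -/
def IsStabilizerState (ψ : (ι → Fin 2) → ℂ) : Prop :=
  ∃ S : Stabilizer ι, stabilizesState S ψ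

/-- `A_ω(ψ)`: the number of stabilizer elements with support exactly `ω`. -/
def Aomega (S : Stabilizer ι) (ω : Finset ι) : ℕ :=
  (S.elems.filter fun M => PauliOp.support M = ω).card

/-- `ω` is a minimal support of `S`: it is the support of some element of `S`, and no
element of `S` has nonempty support strictly contained in `ω`. -/
def IsMinimalSupport (S : Stabilizer ι) (ω : Finset ι) : Prop :=
  (∃ M ∈ S.elems, PauliOp.support M = ω) ∧
    ∀ M ∈ S.elems, PauliOp.support M ⊂ ω → PauliOp.support M = ∅

/-- The matrices of the minimal elements of `S` (the elements whose support is a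
minimal support). -/
def minimalMatrices (S : Stabilizer ι) : Set (Matrix (ι → Fin 2) (ι → Fin 2) ℂ) :=
  {A | ∃ M ∈ S.elems, IsMinimalSupport S (PauliOp.support M) ∧ PauliOp.toMatrix M = A}

/-- `M` belongs to the subgroup `ℳ(ψ)` of `S` generated by the minimal elements.
(Every stabilizer element is an involution, so the generated submonoid coincides with
the generated subgroup.) -/
def inMinimalSubgroup (S : Stabilizer ι) (M : PauliOp ι) : Prop :=
  M ∈ S.elems ∧ PauliOp.toMatrix M ∈ Submonoid.closure (minimalMatrices S)

/-- A one-qubit Clifford operation: a unitary mapping each of the three Pauli matrices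
to a Pauli matrix, up to sign, under conjugation. -/
def IsClifford (U : Matrix (Fin 2) (Fin 2) ℂ) : Prop :=
  U ∈ Matrix.unitaryGroup (Fin 2) ℂ ∧
    ∃ π : Equiv.Perm (Fin 3), ∀ u : Fin 3, ∃ s : ℂ, (s = 1 ∨ s = -1) ∧
      U * pauliMat u.succ * Uᴴ = s • pauliMat (π u).succ

/-- Local unitary equivalence of pure states. -/
def LUequiv (ψ φ : (ι → Fin 2) → ℂ) : Prop :=
  ∃ U : ι → Matrix (Fin 2) (Fin 2) ℂ,
    (∀ i, U i ∈ Matrix.unitaryGroup (Fin 2) ℂ) ∧ (kron U).mulVec ψ = φ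

/-- Local Clifford equivalence of pure states. -/
def LCequiv (ψ φ : (ι → Fin 2) → ℂ) : Prop :=
  ∃ U : ι → Matrix (Fin 2) (Fin 2) ℂ,
    (∀ i, IsClifford (U i)) ∧ (kron U).mulVec ψ = φ

/-- Local Clifford equivalence of (possibly mixed) states. -/
def LCequivMixed (ρ ρ' : Matrix (ι → Fin 2) (ι → Fin 2) ℂ) : Prop :=
  ∃ U : ι → Matrix (Fin 2) (Fin 2) ℂ,
    (∀ i, IsClifford (U i)) ∧ kron U * ρ * (kron U)ᴴ = ρ'

/-- A pure state is fully entangled if it is not a tensor product of states on two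
complementary nonempty subsets of the qubits. -/
def FullyEntangled (ψ : (ι → Fin 2) → ℂ) : Prop :=
  ¬ ∃ (ω : Finset ι) (φ : ({i // i ∈ ω} → Fin 2) → ℂ) (χ : ({i // i ∉ ω} → Fin 2) → ℂ),
      ω ≠ ∅ ∧ ω ≠ Finset.univ ∧
        ∀ x : ι → Fin 2, ψ x = φ (fun i => x i.1) * χ (fun i => x i.1)

/-- Recombine an assignment on `ω` and one on its complement into a global assignment. -/
def mergeAssign (ω : Finset ι) (x : {i // i ∈ ω} → Fin 2) (z : {i // i ∉ ω} → Fin 2) :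
    ι → Fin 2 :=
  fun i => if h : i ∈ ω then x ⟨i, h⟩ else z ⟨i, h⟩

/-- The reduced density matrix `ρ_ω(ψ)` of the pure state `ψ` on the qubits in `ω`
(partial trace of `|ψ⟩⟨ψ|` over the qubits outside `ω`). -/
def reducedState (ψ : (ι → Fin 2) → ℂ) (ω : Finset ι) :
    Matrix ({i // i ∈ ω} → Fin 2) ({i // i ∈ ω} → Fin 2) ℂ :=
  Matrix.of fun x y =>
    ∑ z : {i // i ∉ ω} → Fin 2, ψ (mergeAssign ω x z) * (starRingEnd ℂ) (ψ (mergeAssign ω y z))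

/-- The restriction `α_M M_{i₁} ⊗ ⋯ ⊗ M_{i_k}` of a Pauli operator to the qubits in `ω`. -/
def PauliOp.restrict (M : PauliOp ι) (ω : Finset ι) :
    Matrix ({i // i ∈ ω} → Fin 2) ({i // i ∈ ω} → Fin 2) ℂ :=
  M.phase • kron fun i : {i // i ∈ ω} => pauliMat (M.label i.1)

/-- The `n`-qubit GHZ state `(|0…0⟩ + |1…1⟩)/√2`. -/
def ghz (n : ℕ) : (Fin n → Fin 2) → ℂ :=
  fun x => if x = (fun _ => 0) ∨ x = (fun _ => 1) then ((Real.sqrt 2 : ℝ)⁻¹ : ℂ) else 0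

/-- The `2n × 2n` binary symplectic form `P = [[0, I], [I, 0]]`. -/
def Pmat (n : ℕ) : Matrix (Fin n ⊕ Fin n) (Fin n ⊕ Fin n) (ZMod 2) :=
  Matrix.fromBlocks 0 1 1 0

end

section LocalUnitary

variable {ι : Type} [Fintype ι]

theorem kron_mul [DecidableEq ι] (A B : ι → Matrix (Fin 2) (Fin 2) ℂ) :
    kron A * kron B = kron fun i => A i * B i := by
  ext x y
  simp only [kron, Matrix.mul_apply, Matrix.of_apply, Finset.prod_univ_sum,
    Fintype.piFinset_univ, Finset.prod_mul_distrib]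

theorem kron_one [DecidableEq ι] :
    kron (fun _ : ι => (1 : Matrix (Fin 2) (Fin 2) ℂ)) = 1 := by
  ext x y
  simp [kron, Matrix.one_apply, Finset.prod_ite_zero, funext_iff]

theorem kron_smul (c : ι → ℂ) (A : ι → Matrix (Fin 2) (Fin 2) ℂ) :
    kron (fun i => c i • A i) = (∏ i, c i) • kron A := by
  ext x y
  simp [kron, Finset.prod_mul_distrib]

theorem trace_kron [DecidableEq ι] (A : ι → Matrix (Fin 2) (Fin 2) ℂ) :
    trace (kron A) = ∏ i, trace (A i) := by
  simp only [Matrix.trace, Matrix.diag, kron, Matrix.of_apply, Finset.prod_univ_sum,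
    Fintype.piFinset_univ]

theorem conjTranspose_kron (A : ι → Matrix (Fin 2) (Fin 2) ℂ) :
    (kron A)ᴴ = kron fun i => (A i)ᴴ := by
  ext x y
  simp [kron, Matrix.conjTranspose_apply]

theorem conjTranspose_kron_mul_self [DecidableEq ι] {U : ι → Matrix (Fin 2) (Fin 2) ℂ}
    (hU : ∀ i, U i ∈ Matrix.unitaryGroup (Fin 2) ℂ) : (kron U)ᴴ * kron U = 1 := by
  rw [conjTranspose_kron, kron_mul, ← kron_one]
  congr 1
  funext i
  exact Matrix.mem_unitaryGroup_iff'.mp (hU i)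

theorem kron_conj [DecidableEq ι] (U A : ι → Matrix (Fin 2) (Fin 2) ℂ) :
    kron U * kron A * (kron U)ᴴ = kron fun i => U i * A i * (U i)ᴴ := by
  rw [conjTranspose_kron, kron_mul, kron_mul]

end LocalUnitary

section OneQubit

theorem pauliMat_zero : pauliMat 0 = 1 := rfl

theorem conjTranspose_pauliMat (a : Fin 4) : (pauliMat a)ᴴ = pauliMat a := by
  ext i j
  fin_cases a <;> fin_cases i <;> fin_cases j <;> simp [pauliMat, Matrix.conjTranspose_apply]

theorem pauliMat_mul_self (a : Fin 4) : pauliMat a * pauliMat a = 1 := by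
  ext i j
  fin_cases a <;> fin_cases i <;> fin_cases j <;> simp [pauliMat, Matrix.mul_apply]

theorem trace_pauliMat_mul (a b : Fin 4) :
    trace (pauliMat a * pauliMat b) = if a = b then 2 else 0 := by
  fin_cases a <;> fin_cases b <;>
    simp [pauliMat, Matrix.trace] <;> norm_num

theorem trace_pauliMat (a : Fin 4) : trace (pauliMat a) = if a = 0 then 2 else 0 := by
  simpa [pauliMat_zero] using trace_pauliMat_mul a 0

theorem pauliMat_anticomm {a b : Fin 4} (ha : a ≠ 0) (hb : b ≠ 0) (hab : a ≠ b) :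
    pauliMat a * pauliMat b = (-1 : ℂ) • (pauliMat b * pauliMat a) := by
  ext i j
  fin_cases a <;> fin_cases b <;> simp at ha hb hab <;> fin_cases i <;> fin_cases j <;>
    simp [pauliMat, Matrix.mul_apply]

/-- The label of the product of two Pauli matrices. -/
def pauliLabelMul : Fin 4 → Fin 4 → Fin 4 :=
  ![![0, 1, 2, 3], ![1, 0, 3, 2], ![2, 3, 0, 1], ![3, 2, 1, 0]]

/-- The phase of the product of two Pauli matrices. -/
def pauliPhase : Fin 4 → Fin 4 → ℂ :=
  ![![1, 1, 1, 1], ![1, 1, Complex.I, -Complex.I], ![1, -Complex.I, 1, Complex.I],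
    ![1, Complex.I, -Complex.I, 1]]

theorem pauliMat_mul (a b : Fin 4) :
    pauliMat a * pauliMat b = pauliPhase a b • pauliMat (pauliLabelMul a b) := by
  ext i j
  fin_cases a <;> fin_cases b <;> fin_cases i <;> fin_cases j <;>
    simp [pauliLabelMul, pauliPhase, pauliMat, Matrix.mul_apply]

theorem pauliPhase_ne_zero (a b : Fin 4) : pauliPhase a b ≠ 0 := by
  fin_cases a <;> fin_cases b <;> simp [pauliPhase]

theorem pauliLabelMul_eq_zero {a b : Fin 4} : pauliLabelMul a b = 0 ↔ a = b := by
  revert a b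
  decide

theorem eq_of_ne_of_ne {a b c : Fin 4} (ha : a ≠ 0) (hb : b ≠ 0) (hab : a ≠ b) (hc : c ≠ 0) :
    c = a ∨ c = b ∨ c = pauliLabelMul a b := by
  revert a b c
  decide

theorem eq_sum_pauliMat (X : Matrix (Fin 2) (Fin 2) ℂ) :
    X = ∑ b, (1 / 2 * trace (pauliMat b * X)) • pauliMat b := by
  ext i j
  fin_cases i <;> fin_cases j <;>
    simp [Fin.sum_univ_four, pauliMat, Matrix.trace, Matrix.mul_apply] <;> ring_nf <;>
    simp <;> ring

end OneQubit

section Clifford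

theorem unitaryConj_mul {κ : Type} [Fintype κ] [DecidableEq κ] {U : Matrix κ κ ℂ} (hU : Uᴴ * U = 1)
    (A B : Matrix κ κ ℂ) : U * (A * B) * Uᴴ = U * A * Uᴴ * (U * B * Uᴴ) := by
  calc U * (A * B) * Uᴴ = U * A * 1 * B * Uᴴ := by simp only [mul_one, mul_assoc]
    _ = _ := by rw [← hU]; simp only [mul_assoc]

theorem eq_of_smul_pauliMat_eq {s t : ℂ} {a b : Fin 4} (hs : s ≠ 0)
    (h : s • pauliMat a = t • pauliMat b) : a = b := by
  by_contra hab
  have := congrArg (fun X => trace (pauliMat a * X)) h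
  simp [trace_pauliMat_mul, hab, hs] at this

/-- `U` conjugates `σ_a` to a nontrivial Pauli matrix up to sign. -/
def MapsPauli (U : Matrix (Fin 2) (Fin 2) ℂ) (a : Fin 4) : Prop :=
  ∃ b : Fin 4, b ≠ 0 ∧ ∃ s : ℂ, (s = 1 ∨ s = -1) ∧ U * pauliMat a * Uᴴ = s • pauliMat b

theorem eq_of_conj_eq {U : Matrix (Fin 2) (Fin 2) ℂ} (hU : Uᴴ * U = 1) {a a' b : Fin 4}
    {s s' : ℂ} (hs' : s' = 1 ∨ s' = -1)
    (h : U * pauliMat a * Uᴴ = s • pauliMat b) (h' : U * pauliMat a' * Uᴴ = s' • pauliMat b) :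
    a = a' := by
  have key : U * (s' • pauliMat a) * Uᴴ = U * (s • pauliMat a') * Uᴴ := by
    simp only [Matrix.mul_smul, Matrix.smul_mul, h, h', smul_smul, mul_comm]
  have key' := congrArg (fun X => Uᴴ * X * U) key
  have cancel (X : Matrix (Fin 2) (Fin 2) ℂ) : Uᴴ * (U * X * Uᴴ) * U = X := by
    calc Uᴴ * (U * X * Uᴴ) * U = (Uᴴ * U) * X * (Uᴴ * U) := by simp only [mul_assoc]
      _ = X := by rw [hU, one_mul, mul_one]
  simp only [cancel] at key'
  refine eq_of_smul_pauliMat_eq ?_ key'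
  rcases hs' with rfl | rfl <;> norm_num

theorem isClifford_of_mapsPauli {U : Matrix (Fin 2) (Fin 2) ℂ}
    (hU : U ∈ Matrix.unitaryGroup (Fin 2) ℂ) (h : ∀ a, a ≠ 0 → MapsPauli U a) :
    IsClifford U := by
  have hU' : Uᴴ * U = 1 := Matrix.mem_unitaryGroup_iff'.mp hU
  choose b hb s hs hconj using fun u : Fin 3 => h u.succ (Fin.succ_ne_zero u)
  have hinj : Function.Injective fun u => (b u).pred (hb u) := by
    intro u v huv
    have hbuv : b u = b v := by simpa using huv
    have := hconj v
    rw [← hbuv] at this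
    exact Fin.succ_injective _ (eq_of_conj_eq hU' (hs v) (hconj u) this)
  refine ⟨hU, Equiv.ofBijective _ (Finite.injective_iff_bijective.mp hinj), fun u => ?_⟩
  exact ⟨s u, hs u, by simpa using hconj u⟩

theorem mapsPauli_of_two {U : Matrix (Fin 2) (Fin 2) ℂ} (hU : Uᴴ * U = 1) {a b : Fin 4}
    (ha0 : a ≠ 0) (hb0 : b ≠ 0) (hab : a ≠ b) (ha : MapsPauli U a) (hb : MapsPauli U b)
    (c : Fin 4) (hc : c ≠ 0) : MapsPauli U c := by
  rcases eq_of_ne_of_ne ha0 hb0 hab hc with rfl | rfl | rfl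
  · exact ha
  · exact hb
  obtain ⟨p, -, s, hs, hsp⟩ := ha
  obtain ⟨q, -, t, ht, htq⟩ := hb
  have hpq : p ≠ q := by
    rintro rfl
    exact hab (eq_of_conj_eq hU ht hsp htq)
  set r := (pauliPhase a b)⁻¹ * (s * t * pauliPhase p q) with hr
  have hconj : U * pauliMat (pauliLabelMul a b) * Uᴴ = r • pauliMat (pauliLabelMul p q) := by
    have h1 : pauliMat (pauliLabelMul a b) = (pauliPhase a b)⁻¹ • (pauliMat a * pauliMat b) := by
      rw [pauliMat_mul, smul_smul, inv_mul_cancel₀ (pauliPhase_ne_zero a b), one_smul]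
    rw [h1, Matrix.mul_smul, Matrix.smul_mul, unitaryConj_mul hU, hsp, htq, Matrix.smul_mul,
      Matrix.mul_smul, pauliMat_mul]
    simp only [smul_smul, hr]
    ring_nf
  refine ⟨_, fun h => hpq (pauliLabelMul_eq_zero.mp h), r, ?_, hconj⟩
  have hsq := unitaryConj_mul hU (pauliMat (pauliLabelMul a b)) (pauliMat (pauliLabelMul a b))
  rw [hconj, pauliMat_mul_self, mul_one, mul_eq_one_comm.mp hU, smul_mul_smul_comm,
    pauliMat_mul_self] at hsq
  have := congrFun (congrFun hsq 0) 0
  simp at this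
  exact mul_self_eq_one_iff.mp this.symm

theorem pauliMat_conj {q b : Fin 4} (hq : q ≠ 0) (hb : b ≠ 0) (hqb : q ≠ b) :
    pauliMat q * pauliMat b * pauliMat q = (-1 : ℂ) • pauliMat b := by
  rw [pauliMat_anticomm hq hb hqb, Matrix.smul_mul, mul_assoc, pauliMat_mul_self, mul_one]

theorem pauliMat_mem_unitaryGroup (q : Fin 4) :
    pauliMat q ∈ Matrix.unitaryGroup (Fin 2) ℂ := by
  rw [Matrix.mem_unitaryGroup_iff', Matrix.star_eq_conjTranspose, conjTranspose_pauliMat,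
    pauliMat_mul_self]

/-- The Hermitian unitary exchanging `σ_a` and `σ_b` for distinct nontrivial labels. -/
noncomputable def pauliSwap (a b : Fin 4) : Matrix (Fin 2) (Fin 2) ℂ :=
  ((Real.sqrt 2 : ℝ) : ℂ)⁻¹ • (pauliMat a + pauliMat b)

theorem pauliSwap_conjTranspose (a b : Fin 4) : (pauliSwap a b)ᴴ = pauliSwap a b := by
  simp [pauliSwap, Matrix.conjTranspose_smul, conjTranspose_pauliMat]

theorem inv_sqrt_two_mul_self : ((Real.sqrt 2 : ℝ) : ℂ)⁻¹ * ((Real.sqrt 2 : ℝ) : ℂ)⁻¹ = 2⁻¹ := by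
  rw [← mul_inv, ← Complex.ofReal_mul, Real.mul_self_sqrt (by norm_num)]
  simp

theorem pauliSwap_mul_self {a b : Fin 4} (ha : a ≠ 0) (hb : b ≠ 0) (hab : a ≠ b) :
    pauliSwap a b * pauliSwap a b = 1 := by
  rw [pauliSwap, smul_mul_smul_comm, inv_sqrt_two_mul_self, mul_add, add_mul, add_mul,
    pauliMat_mul_self, pauliMat_mul_self, pauliMat_anticomm ha hb hab]
  ext i j
  simp
  ring

theorem pauliSwap_conj {a b : Fin 4} (ha : a ≠ 0) (hb : b ≠ 0) (hab : a ≠ b) :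
    pauliSwap a b * pauliMat a * pauliSwap a b = pauliMat b := by
  have h : (pauliMat a + pauliMat b) * pauliMat a * (pauliMat a + pauliMat b)
      = (2 : ℂ) • pauliMat b := by
    rw [mul_add, add_mul _ _ (pauliMat a), add_mul, add_mul, pauliMat_mul_self, one_mul, one_mul,
      mul_assoc, pauliMat_mul_self, pauliMat_conj hb ha hab.symm]
    ext i j
    simp
    ring
  rw [pauliSwap, Matrix.smul_mul, smul_mul_smul_comm, inv_sqrt_two_mul_self, h, smul_smul]
  simp

theorem pauliSwap_comm (a b : Fin 4) : pauliSwap a b = pauliSwap b a := by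
  rw [pauliSwap, pauliSwap, add_comm]

theorem exists_isClifford_conj_eq {a b : Fin 4} (ha : a ≠ 0) (hb : b ≠ 0) {s : ℂ}
    (hs : s = 1 ∨ s = -1) : ∃ V, IsClifford V ∧ V * pauliMat a * Vᴴ = s • pauliMat b := by
  obtain ⟨q, hq, hqb⟩ : ∃ q : Fin 4, q ≠ 0 ∧ q ≠ b := by
    revert b
    decide
  have swap : ∃ T, T ∈ Matrix.unitaryGroup (Fin 2) ℂ ∧ T * pauliMat a * Tᴴ = pauliMat b ∧
      ∃ c, c ≠ 0 ∧ c ≠ a ∧ ∃ d, d ≠ 0 ∧ T * pauliMat c * Tᴴ = pauliMat d := by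
    by_cases hab : a = b
    · subst hab
      refine ⟨1, one_mem _, by simp, q, hq, hqb, q, hq, by simp⟩
    · refine ⟨pauliSwap a b, ?_, ?_, b, hb, Ne.symm hab, a, ha, ?_⟩
      · rw [Matrix.mem_unitaryGroup_iff', Matrix.star_eq_conjTranspose, pauliSwap_conjTranspose,
          pauliSwap_mul_self ha hb hab]
      · rw [pauliSwap_conjTranspose, pauliSwap_conj ha hb hab]
      · rw [pauliSwap_conjTranspose, pauliSwap_comm, pauliSwap_conj hb ha (Ne.symm hab)]
  obtain ⟨T, hT, hTa, c, hc, hca, d, hd, hTc⟩ := swap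
  have cliff {V : Matrix (Fin 2) (Fin 2) ℂ} (hV : V ∈ Matrix.unitaryGroup (Fin 2) ℂ)
      (h1 : V * pauliMat a * Vᴴ = s • pauliMat b) (h2 : MapsPauli V c) :
      ∃ V, IsClifford V ∧ V * pauliMat a * Vᴴ = s • pauliMat b :=
    ⟨V, isClifford_of_mapsPauli hV (mapsPauli_of_two (Matrix.mem_unitaryGroup_iff'.mp hV) ha hc
      (Ne.symm hca) ⟨b, hb, s, hs, h1⟩ h2), h1⟩
  rcases hs with rfl | rfl
  · exact cliff hT (by rw [hTa, one_smul]) ⟨d, hd, 1, Or.inl rfl, by rw [hTc, one_smul]⟩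
  · have conj (e : Fin 4) : pauliMat q * T * pauliMat e * (pauliMat q * T)ᴴ
        = pauliMat q * (T * pauliMat e * Tᴴ) * pauliMat q := by
      rw [Matrix.conjTranspose_mul, conjTranspose_pauliMat]
      simp only [mul_assoc]
    refine cliff (mul_mem (pauliMat_mem_unitaryGroup q) hT) ?_ ⟨d, hd, ?_⟩
    · rw [conj, hTa, pauliMat_conj hq hb hqb]
    · by_cases hqd : q = d
      · exact ⟨1, Or.inl rfl, by
          rw [conj, hTc, hqd, pauliMat_mul_self, one_mul, one_smul]⟩
      · exact ⟨-1, Or.inr rfl, by rw [conj, hTc, pauliMat_conj hq hd hqd]⟩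

theorem exists_isClifford_conj_eq_of_mapsPauli {U : Matrix (Fin 2) (Fin 2) ℂ}
    (hU : U ∈ Matrix.unitaryGroup (Fin 2) ℂ) :
    ∃ V, IsClifford V ∧ ∀ a, a ≠ 0 → MapsPauli U a →
      V * pauliMat a * Vᴴ = U * pauliMat a * Uᴴ := by
  by_cases h : ∃ a, a ≠ 0 ∧ MapsPauli U a
  · obtain ⟨a, ha, hUa⟩ := h
    by_cases h2 : ∃ c, c ≠ 0 ∧ a ≠ c ∧ MapsPauli U c
    · obtain ⟨c, hc, hac, hUc⟩ := h2
      exact ⟨U, isClifford_of_mapsPauli hU (mapsPauli_of_two (Matrix.mem_unitaryGroup_iff'.mp hU)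
        ha hc hac hUa hUc), fun _ _ _ => rfl⟩
    · obtain ⟨b, hb, s, hs, hconj⟩ := hUa
      obtain ⟨V, hV, hVa⟩ := exists_isClifford_conj_eq ha hb hs
      refine ⟨V, hV, fun c hc hUc => ?_⟩
      obtain rfl : a = c := by
        by_contra hac
        exact h2 ⟨c, hc, hac, hUc⟩
      rw [hVa, hconj]
  · obtain ⟨V, hV, -⟩ := exists_isClifford_conj_eq (a := 1) (b := 1) one_ne_zero one_ne_zero
      (Or.inl rfl)
    exact ⟨V, hV, fun a ha hUa => absurd ⟨a, ha, hUa⟩ h⟩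

end Clifford

section PauliOperators

theorem PauliOp.phase_ne_zero {ι : Type} (M : PauliOp ι) : M.phase ≠ 0 := by
  rcases M.phase_ok with h | h | h | h <;> simp [h]

theorem conjTranspose_kron_pauliMat {ι : Type} [Fintype ι] (a : ι → Fin 4) :
    (kron fun i => pauliMat (a i))ᴴ = kron fun i => pauliMat (a i) := by
  simp only [conjTranspose_kron, conjTranspose_pauliMat]

variable {ι : Type} [Fintype ι] [DecidableEq ι]

theorem kron_pauliMat_mul (a b : ι → Fin 4) :
    (kron fun i => pauliMat (a i)) * (kron fun i => pauliMat (b i)) =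
      (∏ i, pauliPhase (a i) (b i)) • kron fun i => pauliMat (pauliLabelMul (a i) (b i)) := by
  simp only [kron_mul, pauliMat_mul, kron_smul]

theorem trace_kron_pauliMat_mul (a b : ι → Fin 4) :
    trace ((kron fun i => pauliMat (a i)) * kron fun i => pauliMat (b i)) =
      if a = b then 2 ^ Fintype.card ι else 0 := by
  simp [kron_mul, trace_kron, trace_pauliMat_mul, Finset.prod_ite_zero, funext_iff]

theorem kron_pauliMat_mul_self (a : ι → Fin 4) :
    (kron fun i => pauliMat (a i)) * (kron fun i => pauliMat (a i)) = 1 := by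
  simp only [kron_mul, pauliMat_mul_self, kron_one]

theorem label_eq_of_smul_kron_eq {s t : ℂ} (hs : s ≠ 0) {a b : ι → Fin 4}
    (h : (s • kron fun i => pauliMat (a i)) = t • kron fun i => pauliMat (b i)) : a = b := by
  by_contra hab
  have := congrArg (fun X => trace ((kron fun i => pauliMat (a i)) * X)) h
  simp [trace_kron_pauliMat_mul, hab, hs] at this

theorem PauliOp.toMatrix_injective : Function.Injective (PauliOp.toMatrix (ι := ι)) := by
  intro M N h
  have hl : M.label = N.label := label_eq_of_smul_kron_eq M.phase_ne_zero h
  have hp : M.phase = N.phase := by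
    have := congrArg (fun X => trace ((kron fun i => pauliMat (M.label i)) * X)) h
    simpa [PauliOp.toMatrix, trace_kron_pauliMat_mul, hl] using this
  cases M
  cases N
  simp_all

theorem PauliOp.toMatrix_of_label_eq_zero {M : PauliOp ι} (h : ∀ i, M.label i = 0) :
    M.toMatrix = M.phase • 1 := by
  simp [PauliOp.toMatrix, h, pauliMat_zero, kron_one]

namespace Stabilizer

variable {S : Stabilizer ι} {M N : PauliOp ι}

theorem exists_mul (hM : M ∈ S.elems) (hN : N ∈ S.elems) :
    ∃ K ∈ S.elems, K.toMatrix = M.toMatrix * N.toMatrix ∧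
      ∀ i, K.label i = pauliLabelMul (M.label i) (N.label i) := by
  obtain ⟨K, hK, hKe⟩ := S.mul_mem M hM N hN
  refine ⟨K, hK, hKe, fun i => ?_⟩
  rw [PauliOp.toMatrix, PauliOp.toMatrix, PauliOp.toMatrix, smul_mul_smul_comm,
    kron_pauliMat_mul, smul_smul] at hKe
  exact congrFun (label_eq_of_smul_kron_eq K.phase_ne_zero hKe) i

theorem phase_eq_one (hM : M ∈ S.elems) (h : ∀ i, M.label i = 0) : M.phase = 1 := by
  have hne : ∀ N ∈ S.elems, N.toMatrix ≠ (-1 : ℂ) • 1 := fun N hN => by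
    simpa using S.neg_one_not_mem N hN
  have hMm := PauliOp.toMatrix_of_label_eq_zero h
  obtain ⟨K, hK, hKe, -⟩ := exists_mul hM hM
  rw [hMm, smul_mul_smul_comm, one_mul] at hKe
  rcases M.phase_ok with h1 | h1 | h1 | h1
  · exact h1
  · exact absurd (by rw [hMm, h1]) (hne M hM)
  · exact absurd (by rw [hKe, h1]; simp) (hne K hK)
  · exact absurd (by rw [hKe, h1]; simp) (hne K hK)

theorem phase_mul_phase (hM : M ∈ S.elems) (hN : N ∈ S.elems) (h : M.label = N.label) :
    M.phase * N.phase = 1 := by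
  obtain ⟨K, hK, hKe, hKl⟩ := exists_mul hM hN
  have hK0 : ∀ i, K.label i = 0 := fun i => by
    rw [hKl, h, pauliLabelMul_eq_zero]
  rw [PauliOp.toMatrix_of_label_eq_zero hK0, phase_eq_one hK hK0, PauliOp.toMatrix,
    PauliOp.toMatrix, smul_mul_smul_comm, h, kron_pauliMat_mul_self] at hKe
  have := congrFun (congrFun hKe 0) 0
  simpa using this.symm

theorem phase_eq_one_or (hM : M ∈ S.elems) : M.phase = 1 ∨ M.phase = -1 :=
  mul_self_eq_one_iff.mp (phase_mul_phase hM hM rfl)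

theorem eq_of_label_eq (hM : M ∈ S.elems) (hN : N ∈ S.elems) (h : M.label = N.label) :
    M = N := by
  have hp : M.phase = N.phase :=
    mul_right_cancel₀ N.phase_ne_zero
      ((phase_mul_phase hM hN h).trans (phase_mul_phase hN hN rfl).symm)
  cases M
  cases N
  simp_all

theorem toMatrix_mul_self (hM : M ∈ S.elems) : M.toMatrix * M.toMatrix = 1 := by
  rw [PauliOp.toMatrix, smul_mul_smul_comm, kron_pauliMat_mul_self, phase_mul_phase hM hM rfl,
    one_smul]

theorem conjTranspose_toMatrix (hM : M ∈ S.elems) : M.toMatrixᴴ = M.toMatrix := by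
  rw [PauliOp.toMatrix, Matrix.conjTranspose_smul, conjTranspose_kron_pauliMat]
  rcases phase_eq_one_or hM with h | h <;> simp [h]

theorem toMatrix_mul_sum (hM : M ∈ S.elems) :
    M.toMatrix * ∑ N ∈ S.elems, N.toMatrix = ∑ N ∈ S.elems, N.toMatrix := by
  have hsub : (S.elems.image PauliOp.toMatrix).image (fun X => M.toMatrix * X) ⊆
      S.elems.image PauliOp.toMatrix := by
    intro X hX
    simp only [Finset.mem_image, exists_exists_and_eq_and] at hX ⊢
    obtain ⟨N, hN, rfl⟩ := hX
    exact S.mul_mem M hM N hN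
  have hinj : Function.Injective fun X => M.toMatrix * X := fun X Y h => by
    have := congrArg (fun Z => M.toMatrix * Z) h
    simpa [← mul_assoc, toMatrix_mul_self hM] using this
  have heq := Finset.eq_of_subset_of_card_le hsub (Finset.card_image_of_injective _ hinj).ge
  have hsum : ∑ N ∈ S.elems, N.toMatrix = ∑ X ∈ S.elems.image PauliOp.toMatrix, X :=
    (Finset.sum_image (f := fun X => X) PauliOp.toMatrix_injective.injOn).symm
  rw [hsum, Finset.mul_sum]
  conv_rhs => rw [← heq]
  rw [Finset.sum_image hinj.injOn]

theorem trace_sum_toMatrix : trace (∑ M ∈ S.elems, M.toMatrix) = 2 ^ Fintype.card ι := by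
  obtain ⟨E, hE, hE1⟩ := S.one_mem
  have hE0 : E.label = fun _ => 0 := by
    refine label_eq_of_smul_kron_eq E.phase_ne_zero (t := 1) ?_
    rw [one_smul, show (kron fun _ : ι => pauliMat 0) = 1 from kron_one]
    exact hE1
  rw [Matrix.trace_sum, Finset.sum_eq_single_of_mem E hE, hE1]
  · simp
  · intro M hM hME
    rw [PauliOp.toMatrix, Matrix.trace_smul, trace_kron]
    obtain ⟨i, hi⟩ : ∃ i, M.label i ≠ 0 := by
      by_contra! h
      exact hME (eq_of_label_eq hM hE (by rw [hE0]; exact funext h))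
    rw [Finset.prod_eq_zero (Finset.mem_univ i) (by simp [trace_pauliMat, hi]), smul_zero]

end Stabilizer

open scoped ComplexOrder in
theorem eq_vecMulVec_of_idempotent {κ : Type} [Fintype κ] [DecidableEq κ] {Q : Matrix κ κ ℂ}
    (hQ : Qᴴ = Q) (hQ2 : Q * Q = Q) (htr : trace Q = 1) {v : κ → ℂ}
    (hv : star v ⬝ᵥ v = 1) (hQv : Q *ᵥ v = v) : Q = vecMulVec v (star v) := by
  set P := vecMulVec v (star v) with hP
  have hPH : Pᴴ = P := by simp [hP, Matrix.conjTranspose_vecMulVec]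
  have hQP : Q * P = P := by rw [hP, Matrix.mul_vecMulVec, hQv]
  have hPQ : P * Q = P := by
    have := congrArg conjTranspose hQP
    rwa [Matrix.conjTranspose_mul, hQ, hPH] at this
  have hPP : P * P = P := by
    rw [hP, Matrix.vecMulVec_mul_vecMulVec, hv]
    simp
  have hPt : trace P = 1 := by rw [hP, Matrix.trace_vecMulVec, dotProduct_comm, hv]
  have key : (Q - P)ᴴ * (Q - P) = Q - P := by
    rw [Matrix.conjTranspose_sub, hQ, hPH, sub_mul, mul_sub, mul_sub, hQ2, hQP, hPQ, hPP]
    simp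
  refine sub_eq_zero.mp (Matrix.trace_conjTranspose_mul_self_eq_zero_iff.mp ?_)
  rw [key, Matrix.trace_sub, htr, hPt, sub_self]

theorem star_dotProduct_self_eq_one {κ : Type} [Fintype κ] {v : κ → ℂ}
    (h : ∑ x, Complex.normSq (v x) = 1) : star v ⬝ᵥ v = 1 := by
  have : star v ⬝ᵥ v = ((∑ x, Complex.normSq (v x) : ℝ) : ℂ) := by
    simp [dotProduct, Complex.normSq_eq_conj_mul_self]
  rw [this, h, Complex.ofReal_one]

theorem sum_toMatrix_eq_vecMulVec {S : Stabilizer ι} {ψ : (ι → Fin 2) → ℂ}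
    (h : stabilizesState S ψ) :
    ∑ M ∈ S.elems, M.toMatrix = (2 ^ Fintype.card ι : ℂ) • vecMulVec ψ (star ψ) := by
  have h2 : (2 ^ Fintype.card ι : ℂ) ≠ 0 := pow_ne_zero _ two_ne_zero
  set T := ∑ M ∈ S.elems, M.toMatrix with hT
  have hTT : T * T = (2 ^ Fintype.card ι : ℂ) • T := by
    conv_lhs => rw [hT, Finset.sum_mul]
    rw [Finset.sum_congr rfl fun M hM => Stabilizer.toMatrix_mul_sum hM, Finset.sum_const,
      S.card_elems, ← Nat.cast_smul_eq_nsmul ℂ]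
    simp [hT]
  rw [← inv_smul_eq_iff₀ h2]
  refine eq_vecMulVec_of_idempotent ?_ ?_ ?_ (star_dotProduct_self_eq_one h.1) ?_
  · rw [Matrix.conjTranspose_smul, hT, Matrix.conjTranspose_sum,
      Finset.sum_congr rfl fun M hM => Stabilizer.conjTranspose_toMatrix hM]
    simp
  · rw [smul_mul_smul_comm, hTT, smul_smul, mul_assoc, inv_mul_cancel₀ h2, mul_one]
  · rw [Matrix.trace_smul, hT, Stabilizer.trace_sum_toMatrix, smul_eq_mul, inv_mul_cancel₀ h2]
  · rw [Matrix.smul_mulVec, hT, Matrix.sum_mulVec, Finset.sum_congr rfl fun M hM => h.2 M hM,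
      Finset.sum_const, S.card_elems, ← Nat.cast_smul_eq_nsmul ℂ, smul_smul]
    simp

end PauliOperators

section Factorization

theorem mergeAssign_restrict {ι : Type} [DecidableEq ι] (ω : Finset ι) (x : ι → Fin 2) :
    mergeAssign ω (fun i => x i.1) (fun i => x i.1) = x := by
  funext i
  by_cases h : i ∈ ω <;> simp [mergeAssign, h]

theorem PauliOp.trace_restrict {ι : Type} [DecidableEq ι] {M : PauliOp ι} {ω : Finset ι}
    (h : ∃ i ∈ ω, M.label i ≠ 0) : trace (M.restrict ω) = 0 := by
  obtain ⟨i, hi, hne⟩ := h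
  rw [PauliOp.restrict, Matrix.trace_smul, trace_kron,
    Finset.prod_eq_zero (Finset.mem_univ ⟨i, hi⟩) (by simp [trace_pauliMat, hne]), smul_zero]

theorem PauliOp.trace_restrict_mul {ι : Type} [DecidableEq ι] {M N : PauliOp ι} {ω : Finset ι}
    (h : ∃ i ∈ ω, M.label i ≠ N.label i) : trace (M.restrict ω * N.restrict ω) = 0 := by
  obtain ⟨i, hi, hne⟩ := h
  rw [PauliOp.restrict, PauliOp.restrict, smul_mul_smul_comm, Matrix.trace_smul,
    trace_kron_pauliMat_mul, if_neg, smul_zero]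
  exact fun h => hne (congrFun h ⟨i, hi⟩)

variable {ι : Type} [Fintype ι] [DecidableEq ι]

theorem prod_mem_mul_prod_notMem (ω : Finset ι) (f : ι → ℂ) :
    (∏ i : {i // i ∈ ω}, f i) * ∏ i : {i // i ∉ ω}, f i = ∏ i, f i := by
  convert Fintype.prod_subtype_mul_prod_subtype (fun i => i ∈ ω) f

theorem not_fullyEntangled_of_idempotent {ψ : (ι → Fin 2) → ℂ} {ω : Finset ι} (h0 : ω ≠ ∅)
    (h1 : ω ≠ Finset.univ) {E : Matrix ({i // i ∈ ω} → Fin 2) ({i // i ∈ ω} → Fin 2) ℂ}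
    (hE : Eᴴ = E) (hE2 : E * E = E) (htr : trace E = 1)
    (hfix : ∀ z, (E *ᵥ fun x => ψ (mergeAssign ω x z)) = fun x => ψ (mergeAssign ω x z)) :
    ¬ FullyEntangled ψ := by
  intro hent
  by_cases hψ : ∀ x, ψ x = 0
  · exact hent ⟨ω, 0, 0, h0, h1, by simpa using hψ⟩
  push Not at hψ
  obtain ⟨x₀, hx₀⟩ := hψ
  set v : ({i // i ∈ ω} → Fin 2) → ℂ := fun x => ψ (mergeAssign ω x fun i => x₀ i.1) with hv
  set r : ℝ := ∑ x, Complex.normSq (v x) with hr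
  have hrpos : 0 < r := by
    refine Finset.sum_pos' (fun x _ => Complex.normSq_nonneg _)
      ⟨fun i => x₀ i.1, Finset.mem_univ _, Complex.normSq_pos.mpr ?_⟩
    simpa only [hv, mergeAssign_restrict] using hx₀
  set u : ({i // i ∈ ω} → Fin 2) → ℂ := (((Real.sqrt r)⁻¹ : ℝ) : ℂ) • v with hu
  have hunit : star u ⬝ᵥ u = 1 := by
    refine star_dotProduct_self_eq_one ?_
    simp only [hu, Pi.smul_apply, smul_eq_mul, Complex.normSq_mul, Complex.normSq_ofReal,
      ← Finset.mul_sum, ← hr]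
    rw [← mul_inv, Real.mul_self_sqrt hrpos.le, inv_mul_cancel₀ hrpos.ne']
  have hEu : E *ᵥ u = u := by rw [hu, Matrix.mulVec_smul, hv, hfix]
  have hEeq := eq_vecMulVec_of_idempotent hE hE2 htr hunit hEu
  refine hent ⟨ω, u, fun z => star u ⬝ᵥ fun x => ψ (mergeAssign ω x z), h0, h1, fun x => ?_⟩
  have := congrFun (hfix fun i => x i.1) fun i => x i.1
  rw [hEeq, Matrix.vecMulVec_mulVec, mergeAssign_restrict] at this
  rw [← this]
  simp

theorem PauliOp.mem_support {M : PauliOp ι} {i : ι} : i ∈ M.support ↔ M.label i ≠ 0 := by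
  simp [PauliOp.support]

theorem PauliOp.label_eq_zero {M : PauliOp ι} {ω : Finset ι} (hM : M.support ⊆ ω) {i : ι}
    (hi : i ∉ ω) : M.label i = 0 := by
  by_contra h
  exact hi (hM (PauliOp.mem_support.mpr h))

theorem PauliOp.restrict_mulVec {M : PauliOp ι} {ω : Finset ι} (hM : M.support ⊆ ω)
    (ψ : (ι → Fin 2) → ℂ) (z : {i // i ∉ ω} → Fin 2) :
    (M.restrict ω *ᵥ fun x => ψ (mergeAssign ω x z)) =
      fun x => (M.toMatrix *ᵥ ψ) (mergeAssign ω x z) := by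
  funext x
  simp only [Matrix.mulVec, dotProduct, PauliOp.restrict, PauliOp.toMatrix, Matrix.smul_apply,
    kron, Matrix.of_apply]
  rw [← (Equiv.piEquivPiSubtypeProd (fun i => i ∈ ω) fun _ => Fin 2).symm.sum_comp,
    Fintype.sum_prod_type]
  refine Finset.sum_congr rfl fun y _ => ?_
  have hmerge (w : {i // i ∉ ω} → Fin 2) :
      (Equiv.piEquivPiSubtypeProd (fun i => i ∈ ω) fun _ => Fin 2).symm (y, w) =
        mergeAssign ω y w := rfl
  have hprod (w : {i // i ∉ ω} → Fin 2) :
      ∏ i, pauliMat (M.label i) (mergeAssign ω x z i) (mergeAssign ω y w i) =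
        (∏ i : {i // i ∈ ω}, pauliMat (M.label i.1) (x i) (y i)) * if z = w then 1 else 0 := by
    rw [← prod_mem_mul_prod_notMem ω]
    congr 1
    · exact Finset.prod_congr rfl fun i _ => by simp [mergeAssign, i.2]
    · rw [Finset.prod_congr rfl (g := fun i => if z i = w i then (1 : ℂ) else 0)]
      · simp [Finset.prod_ite_zero, funext_iff]
      · intro i _
        simp [mergeAssign, i.2, PauliOp.label_eq_zero hM i.2, pauliMat_zero, Matrix.one_apply]
  simp only [hmerge, hprod]
  rw [Finset.sum_eq_single z]
  · simp
  · intro w _ hw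
    simp [Ne.symm hw]
  · simp

/-- The sign relating `σ_a σ_b` and `σ_b σ_a`. -/
def pauliCommSign (a b : Fin 4) : ℂ := if a = 0 ∨ b = 0 ∨ a = b then 1 else -1

theorem pauliMat_comm (a b : Fin 4) :
    pauliMat a * pauliMat b = pauliCommSign a b • (pauliMat b * pauliMat a) := by
  unfold pauliCommSign
  split_ifs with h
  · rcases h with rfl | rfl | rfl <;> simp [pauliMat_zero]
  · push Not at h
    exact pauliMat_anticomm h.1 h.2.1 h.2.2

theorem kron_pauliMat_comm (a b : ι → Fin 4) :
    (kron fun i => pauliMat (a i)) * (kron fun i => pauliMat (b i)) =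
      (∏ i, pauliCommSign (a i) (b i)) •
        ((kron fun i => pauliMat (b i)) * kron fun i => pauliMat (a i)) := by
  rw [kron_mul, kron_mul, ← kron_smul]
  simp only [← pauliMat_comm]

namespace Stabilizer

variable {S : Stabilizer ι} {M N : PauliOp ι}

theorem prod_pauliCommSign (hM : M ∈ S.elems) (hN : N ∈ S.elems) :
    ∏ i, pauliCommSign (M.label i) (N.label i) = 1 := by
  have h := S.comm M hM N hN
  rw [PauliOp.toMatrix, PauliOp.toMatrix, smul_mul_smul_comm, smul_mul_smul_comm,
    kron_pauliMat_comm, mul_comm N.phase, kron_pauliMat_mul] at h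
  rw [smul_smul, smul_smul, smul_smul] at h
  have hne := mul_ne_zero (mul_ne_zero M.phase_ne_zero N.phase_ne_zero)
    (Finset.prod_ne_zero_iff.mpr fun i (_ : i ∈ Finset.univ) =>
      pauliPhase_ne_zero (N.label i) (M.label i))
  have h' := congrArg (fun X =>
    trace ((kron fun i => pauliMat (pauliLabelMul (N.label i) (M.label i))) * X)) h
  simp only [Matrix.mul_smul, Matrix.trace_smul, kron_pauliMat_mul_self, smul_eq_mul] at h'
  have htr : trace (1 : Matrix (ι → Fin 2) (ι → Fin 2) ℂ) ≠ 0 := by simp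
  have hcancel := mul_right_cancel₀ htr h'
  refine mul_left_cancel₀ hne ?_
  refine Eq.trans ?_ (hcancel.trans (mul_one _).symm)
  ring

theorem conjTranspose_restrict (hM : M ∈ S.elems) (ω : Finset ι) :
    (M.restrict ω)ᴴ = M.restrict ω := by
  rw [PauliOp.restrict, Matrix.conjTranspose_smul, conjTranspose_kron_pauliMat]
  rcases phase_eq_one_or hM with h | h <;> simp [h]

theorem restrict_mul_self (hM : M ∈ S.elems) (ω : Finset ι) :
    M.restrict ω * M.restrict ω = 1 := by
  rw [PauliOp.restrict, smul_mul_smul_comm, kron_pauliMat_mul_self, phase_mul_phase hM hM rfl,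
    one_smul]

theorem restrict_comm {ω : Finset ι} (hM : M ∈ S.elems) (hN : N ∈ S.elems)
    (hMω : M.support ⊆ ω) : M.restrict ω * N.restrict ω = N.restrict ω * M.restrict ω := by
  have h := prod_pauliCommSign hM hN
  rw [← prod_mem_mul_prod_notMem ω,
    Finset.prod_eq_one (s := (Finset.univ : Finset {i // i ∉ ω})), mul_one] at h
  · rw [PauliOp.restrict, PauliOp.restrict, smul_mul_smul_comm, smul_mul_smul_comm,
      kron_pauliMat_comm, h, one_smul, mul_comm N.phase]
  · intro i _
    simp [pauliCommSign, PauliOp.label_eq_zero hMω i.2]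

variable {ψ : (ι → Fin 2) → ℂ}

theorem restrict_mulVec_eq {ω : Finset ι} (hψ : stabilizesState S ψ) (hM : M ∈ S.elems)
    (hMω : M.support ⊆ ω) (z : {i // i ∉ ω} → Fin 2) :
    (M.restrict ω *ᵥ fun x => ψ (mergeAssign ω x z)) = fun x => ψ (mergeAssign ω x z) := by
  rw [PauliOp.restrict_mulVec hMω, hψ.2 M hM]

theorem card_support_ne_one (hψ : stabilizesState S ψ) (hent : FullyEntangled ψ)
    (hι : 1 < Fintype.card ι) (hM : M ∈ S.elems) : M.support.card ≠ 1 := by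
  intro hcard
  have h0 : M.support ≠ ∅ := by
    intro h
    simp [h] at hcard
  have h1 : M.support ≠ Finset.univ := by
    intro h
    rw [h, Finset.card_univ] at hcard
    omega
  obtain ⟨i, hi⟩ := Finset.nonempty_iff_ne_empty.mpr h0
  refine not_fullyEntangled_of_idempotent (E := (1 / 2 : ℂ) • (1 + M.restrict M.support))
    h0 h1 ?_ ?_ ?_ (fun z => ?_) hent
  · simp [Matrix.conjTranspose_smul, conjTranspose_restrict hM]
  · rw [smul_mul_smul_comm, mul_add, add_mul, add_mul, restrict_mul_self hM]
    ext x y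
    simp
    ring
  · rw [Matrix.trace_smul, Matrix.trace_add,
      PauliOp.trace_restrict ⟨i, hi, PauliOp.mem_support.mp hi⟩]
    simp [hcard]
  · rw [Matrix.smul_mulVec, Matrix.add_mulVec, restrict_mulVec_eq hψ hM subset_rfl,
      Matrix.one_mulVec]
    funext x
    simp
    ring

theorem label_eq_of_card_support_eq_two (hψ : stabilizesState S ψ) (hent : FullyEntangled ψ)
    (hι : 2 < Fintype.card ι) (hM : M ∈ S.elems) (hN : N ∈ S.elems)
    (hsupp : N.support = M.support) (hcard : M.support.card = 2) : M.label = N.label := by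
  by_contra hne
  have h0 : M.support ≠ ∅ := by
    intro h
    simp [h] at hcard
  have h1 : M.support ≠ Finset.univ := by
    intro h
    rw [h, Finset.card_univ] at hcard
    omega
  obtain ⟨i, hi⟩ := Finset.nonempty_iff_ne_empty.mpr h0
  obtain ⟨j, hj⟩ := Function.ne_iff.mp hne
  have hjω : j ∈ M.support := by
    by_contra hjω
    rw [PauliOp.label_eq_zero subset_rfl hjω, PauliOp.label_eq_zero hsupp.subset hjω] at hj
    exact hj rfl
  set A := M.restrict M.support
  set B := N.restrict M.support
  have hA : A * A = 1 := restrict_mul_self hM _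
  have hB : B * B = 1 := restrict_mul_self hN _
  have hAB : A * B = B * A := restrict_comm hM hN subset_rfl
  refine not_fullyEntangled_of_idempotent (E := (1 / 4 : ℂ) • (1 + A + B + A * B))
    h0 h1 ?_ ?_ ?_ (fun z => ?_) hent
  · have hAH : Aᴴ = A := conjTranspose_restrict hM _
    have hBH : Bᴴ = B := conjTranspose_restrict hN _
    simp [Matrix.conjTranspose_smul, hAH, hBH, ← hAB]
  · have h1 : A * (A * B) = B := by rw [← mul_assoc, hA, one_mul]
    have h2 : B * (A * B) = A := by rw [hAB, ← mul_assoc, hB, one_mul]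
    have h3 : A * B * A = B := by rw [hAB, mul_assoc, hA, mul_one]
    have h4 : A * B * B = A := by rw [mul_assoc, hB, mul_one]
    have h5 : A * B * (A * B) = 1 := by rw [← mul_assoc, h3, hB]
    have h6 : (1 + A + B + A * B) * (1 + A + B + A * B) = (4 : ℂ) • (1 + A + B + A * B) := by
      simp only [mul_add, add_mul, mul_one, one_mul, hA, hB, h1, h2, h3, h4, h5, ← hAB]
      module
    rw [smul_mul_smul_comm, h6, smul_smul]
    norm_num
  · have hM0 : M.label i ≠ 0 := PauliOp.mem_support.mp hi
    have hN0 : N.label i ≠ 0 := PauliOp.mem_support.mp (hsupp ▸ hi)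
    rw [Matrix.trace_smul, Matrix.trace_add, Matrix.trace_add, Matrix.trace_add,
      PauliOp.trace_restrict ⟨i, hi, hM0⟩, PauliOp.trace_restrict ⟨i, hi, hN0⟩,
      PauliOp.trace_restrict_mul ⟨j, hjω, hj⟩]
    simp [hcard]
  · rw [Matrix.smul_mulVec, Matrix.add_mulVec, Matrix.add_mulVec, Matrix.add_mulVec,
      ← Matrix.mulVec_mulVec, restrict_mulVec_eq hψ hN hsupp.subset,
      restrict_mulVec_eq hψ hM subset_rfl, Matrix.one_mulVec]
    funext x
    simp
    ring

end Stabilizer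

end Factorization

section PauliTransfer

/-- The entry of the Pauli transfer matrix of `U`: the `σ_b`-coefficient of `U σ_a Uᴴ`. -/
noncomputable def pauliCoeff (U : Matrix (Fin 2) (Fin 2) ℂ) (b a : Fin 4) : ℂ :=
  1 / 2 * trace (pauliMat b * (U * pauliMat a * Uᴴ))

variable {U : Matrix (Fin 2) (Fin 2) ℂ}

theorem conj_pauliMat_eq_sum (U : Matrix (Fin 2) (Fin 2) ℂ) (a : Fin 4) :
    U * pauliMat a * Uᴴ = ∑ b, pauliCoeff U b a • pauliMat b :=
  eq_sum_pauliMat _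

theorem trace_pauliMat_mul_conj (U : Matrix (Fin 2) (Fin 2) ℂ) (b a : Fin 4) :
    trace (pauliMat b * (U * pauliMat a * Uᴴ)) = 2 * pauliCoeff U b a := by
  rw [pauliCoeff]
  ring

theorem pauliCoeff_zero_right (hU : U ∈ Matrix.unitaryGroup (Fin 2) ℂ) (b : Fin 4) :
    pauliCoeff U b 0 = if b = 0 then 1 else 0 := by
  have hU' : U * Uᴴ = 1 := Matrix.mem_unitaryGroup_iff.mp hU
  rw [pauliCoeff, pauliMat_zero, mul_one, hU', mul_one, trace_pauliMat]
  split_ifs <;> norm_num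

theorem trace_unitaryConj (hU : U ∈ Matrix.unitaryGroup (Fin 2) ℂ)
    (X : Matrix (Fin 2) (Fin 2) ℂ) : trace (U * X * Uᴴ) = trace X := by
  have hU' : Uᴴ * U = 1 := Matrix.mem_unitaryGroup_iff'.mp hU
  rw [Matrix.trace_mul_comm, ← mul_assoc, hU', one_mul]

theorem pauliCoeff_zero_left (hU : U ∈ Matrix.unitaryGroup (Fin 2) ℂ) {a : Fin 4} (ha : a ≠ 0) :
    pauliCoeff U 0 a = 0 := by
  rw [pauliCoeff, pauliMat_zero, one_mul, trace_unitaryConj hU, trace_pauliMat, if_neg ha,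
    mul_zero]

theorem eq_zero_iff_of_pauliCoeff_ne_zero (hU : U ∈ Matrix.unitaryGroup (Fin 2) ℂ)
    {a b : Fin 4} (h : pauliCoeff U b a ≠ 0) : b = 0 ↔ a = 0 := by
  refine ⟨fun hb => ?_, fun ha => ?_⟩
  · by_contra ha
    exact h (hb ▸ pauliCoeff_zero_left hU ha)
  · by_contra hb
    exact h (by rw [ha, pauliCoeff_zero_right hU, if_neg hb])

theorem sum_pauliCoeff_mul (hU : U ∈ Matrix.unitaryGroup (Fin 2) ℂ) (a a' : Fin 4) :
    ∑ b, pauliCoeff U b a * pauliCoeff U b a' = if a = a' then 1 else 0 := by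
  have hU' : Uᴴ * U = 1 := Matrix.mem_unitaryGroup_iff'.mp hU
  have h : trace (U * pauliMat a * Uᴴ * (U * pauliMat a' * Uᴴ)) = if a = a' then 2 else 0 := by
    rw [← unitaryConj_mul hU', trace_unitaryConj hU, trace_pauliMat_mul]
  rw [conj_pauliMat_eq_sum U a, Finset.sum_mul, Matrix.trace_sum] at h
  simp only [Matrix.smul_mul, Matrix.trace_smul, trace_pauliMat_mul_conj, smul_eq_mul] at h
  rw [← mul_right_inj' (two_ne_zero (α := ℂ)), Finset.mul_sum,
    Finset.sum_congr rfl fun b _ => mul_left_comm 2 (pauliCoeff U b a) (pauliCoeff U b a'), h]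
  split_ifs <;> norm_num

theorem exists_pauliCoeff_ne_zero (hU : U ∈ Matrix.unitaryGroup (Fin 2) ℂ) (a : Fin 4) :
    ∃ b, pauliCoeff U b a ≠ 0 := by
  by_contra! h
  simpa [h] using sum_pauliCoeff_mul hU a a

theorem mapsPauli_of_pauliCoeff (hU : U ∈ Matrix.unitaryGroup (Fin 2) ℂ) {a : Fin 4}
    (ha : a ≠ 0) (h : ∀ b b', pauliCoeff U b a ≠ 0 → pauliCoeff U b' a ≠ 0 → b = b') :
    MapsPauli U a := by
  obtain ⟨b, hb⟩ := exists_pauliCoeff_ne_zero hU a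
  have h0 (c : Fin 4) (hc : c ≠ b) : pauliCoeff U c a = 0 := by
    by_contra hne
    exact hc (h c b hne hb)
  refine ⟨b, fun hb0 => ha ((eq_zero_iff_of_pauliCoeff_ne_zero hU hb).mp hb0), pauliCoeff U b a,
    ?_, ?_⟩
  · have := sum_pauliCoeff_mul hU a a
    rw [Finset.sum_eq_single b (fun c _ hc => by rw [h0 c hc, zero_mul]) (by simp), if_pos rfl]
      at this
    exact mul_self_eq_one_iff.mp this
  · rw [conj_pauliMat_eq_sum, Finset.sum_eq_single b (fun c _ hc => by rw [h0 c hc, zero_smul])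
      (by simp)]

end PauliTransfer

section LocalUnitaryImage

variable {ι : Type} [Fintype ι] [DecidableEq ι] {S S' : Stabilizer ι} {M N : PauliOp ι}

theorem Stabilizer.label_eq_of_minimal {ω : Finset ι}
    (hmin : ∀ K ∈ S.elems, K.support ⊂ ω → K.support = ∅) (hM : M ∈ S.elems) (hN : N ∈ S.elems)
    (hMω : M.support ⊆ ω) (hNω : N.support ⊆ ω) {i : ι} (hi : i ∈ ω)
    (h : M.label i = N.label i) : M.label = N.label := by
  obtain ⟨K, hK, -, hKl⟩ := exists_mul hM hN
  have hss : K.support ⊂ ω := by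
    refine (Finset.ssubset_iff_of_subset fun l hl => ?_).mpr ⟨i, hi, ?_⟩
    · by_contra hlω
      refine PauliOp.mem_support.mp hl ?_
      rw [hKl, pauliLabelMul_eq_zero, PauliOp.label_eq_zero hMω hlω,
        PauliOp.label_eq_zero hNω hlω]
    · rw [PauliOp.mem_support, not_not, hKl, pauliLabelMul_eq_zero, h]
  have hK0 := hmin K hK hss
  funext l
  rw [← pauliLabelMul_eq_zero, ← hKl]
  exact PauliOp.label_eq_zero hK0.subset (Finset.notMem_empty l)

variable {U : ι → Matrix (Fin 2) (Fin 2) ℂ}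

theorem kron_conj_toMatrix (U : ι → Matrix (Fin 2) (Fin 2) ℂ) (M : PauliOp ι) :
    kron U * M.toMatrix * (kron U)ᴴ =
      M.phase • kron fun i => U i * pauliMat (M.label i) * (U i)ᴴ := by
  rw [PauliOp.toMatrix, Matrix.mul_smul, Matrix.smul_mul, kron_conj]

theorem sum_phase_mul_prod_pauliCoeff
    (hkey : kron U * (∑ M ∈ S.elems, M.toMatrix) * (kron U)ᴴ = ∑ M ∈ S'.elems, M.toMatrix)
    (b : ι → Fin 4) :
    ∑ M ∈ S.elems, M.phase * ∏ i, pauliCoeff (U i) (b i) (M.label i) =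
      ∑ M ∈ S'.elems, if b = M.label then M.phase else 0 := by
  have h := congrArg (fun X => trace ((kron fun i => pauliMat (b i)) * X)) hkey
  simp only [Finset.mul_sum, Finset.sum_mul, Matrix.trace_sum, kron_conj_toMatrix,
    Matrix.mul_smul, Matrix.trace_smul, kron_mul, trace_kron, trace_pauliMat_mul_conj,
    Finset.prod_mul_distrib, smul_eq_mul] at h
  have h2 : (2 ^ Fintype.card ι : ℂ) ≠ 0 := pow_ne_zero _ two_ne_zero
  rw [← mul_right_inj' h2, Finset.mul_sum, Finset.mul_sum]
  refine Eq.trans (Finset.sum_congr rfl fun M _ => ?_)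
    (h.trans (Finset.sum_congr rfl fun M _ => ?_))
  · rw [Finset.prod_const, Finset.card_univ]
    ring
  · rw [PauliOp.toMatrix, Matrix.mul_smul, Matrix.trace_smul, trace_kron_pauliMat_mul]
    split_ifs <;> simp [mul_comm]

theorem exists_label_eq_of_sum_ne_zero
    (hkey : kron U * (∑ M ∈ S.elems, M.toMatrix) * (kron U)ᴴ = ∑ M ∈ S'.elems, M.toMatrix)
    {b : ι → Fin 4}
    (hb : ∑ M ∈ S.elems, M.phase * ∏ i, pauliCoeff (U i) (b i) (M.label i) ≠ 0) :
    ∃ M ∈ S'.elems, M.label = b := by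
  rw [sum_phase_mul_prod_pauliCoeff hkey] at hb
  obtain ⟨M, hM, hne⟩ := Finset.exists_ne_zero_of_sum_ne_zero hb
  exact ⟨M, hM, by_contra fun h => hne (if_neg fun h' => h h'.symm)⟩

theorem exists_support_eq_of_mem_image (hU : ∀ i, U i ∈ Matrix.unitaryGroup (Fin 2) ℂ)
    (hkey : kron U * (∑ M ∈ S.elems, M.toMatrix) * (kron U)ᴴ = ∑ M ∈ S'.elems, M.toMatrix)
    (hN : N ∈ S'.elems) : ∃ M ∈ S.elems, M.support = N.support := by
  have h := sum_phase_mul_prod_pauliCoeff hkey N.label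
  rw [Finset.sum_eq_single_of_mem N hN, if_pos rfl] at h
  · obtain ⟨M, hM, hne⟩ := Finset.exists_ne_zero_of_sum_ne_zero (h.trans_ne N.phase_ne_zero)
    refine ⟨M, hM, Finset.ext fun i => ?_⟩
    have hi := Finset.prod_ne_zero_iff.mp (right_ne_zero_of_mul hne) i (Finset.mem_univ i)
    rw [PauliOp.mem_support, PauliOp.mem_support, not_iff_not,
      eq_zero_iff_of_pauliCoeff_ne_zero (hU i) hi]
  · exact fun M hM hMN => if_neg fun hl => hMN (Stabilizer.eq_of_label_eq hM hN hl.symm)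

theorem minimal_image (hU : ∀ i, U i ∈ Matrix.unitaryGroup (Fin 2) ℂ)
    (hkey : kron U * (∑ M ∈ S.elems, M.toMatrix) * (kron U)ᴴ = ∑ M ∈ S'.elems, M.toMatrix)
    {ω : Finset ι} (hmin : ∀ K ∈ S.elems, K.support ⊂ ω → K.support = ∅) :
    ∀ K ∈ S'.elems, K.support ⊂ ω → K.support = ∅ := by
  intro K hK hKω
  obtain ⟨M, hM, hMK⟩ := exists_support_eq_of_mem_image hU hkey hK
  rw [← hMK] at hKω ⊢
  exact hmin M hM hKω

variable {ψ : (ι → Fin 2) → ℂ}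

theorem Stabilizer.eq_of_label_eq_off_pair (hψ : stabilizesState S ψ) (hent : FullyEntangled ψ)
    (hι : 2 < Fintype.card ι) (hN : N ∈ S.elems)
    (hmin : ∀ K ∈ S.elems, K.support ⊂ N.support → K.support = ∅) {i j : ι}
    (hi : i ∈ N.support) (hj : j ∈ N.support) (hij : i ≠ j) (hM : M ∈ S.elems)
    (hMi : M.label i ≠ 0) (hMj : M.label j ≠ 0)
    (h : ∀ l, l ≠ i → l ≠ j → M.label l = N.label l) : M = N := by
  refine eq_of_label_eq hM hN ?_
  have hsupp : M.support = N.support := by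
    ext l
    by_cases hli : l = i
    · subst hli
      simpa [PauliOp.mem_support, hMi] using PauliOp.mem_support.mp hi
    by_cases hlj : l = j
    · subst hlj
      simpa [PauliOp.mem_support, hMj] using PauliOp.mem_support.mp hj
    rw [PauliOp.mem_support, PauliOp.mem_support, h l hli hlj]
  by_cases hex : ∃ k ∈ N.support, k ≠ i ∧ k ≠ j
  · obtain ⟨k, hk, hki, hkj⟩ := hex
    exact label_eq_of_minimal hmin hM hN hsupp.subset subset_rfl hk (h k hki hkj)
  · push Not at hex
    have hpair : N.support = {i, j} := by
      ext k
      rw [Finset.mem_insert, Finset.mem_singleton]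
      refine ⟨fun hk => or_iff_not_imp_left.mpr (hex k hk), ?_⟩
      rintro (rfl | rfl) <;> assumption
    exact (label_eq_of_card_support_eq_two hψ hent hι hN hM hsupp
      (by rw [hpair, Finset.card_pair hij])).symm

theorem exists_mem_image_label_pair (hU : ∀ i, U i ∈ Matrix.unitaryGroup (Fin 2) ℂ)
    (hkey : kron U * (∑ M ∈ S.elems, M.toMatrix) * (kron U)ᴴ = ∑ M ∈ S'.elems, M.toMatrix)
    (hψ : stabilizesState S ψ) (hent : FullyEntangled ψ)
    (hι : 2 < Fintype.card ι) (hN : N ∈ S.elems)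
    (hmin : ∀ K ∈ S.elems, K.support ⊂ N.support → K.support = ∅) {i j : ι}
    (hi : i ∈ N.support) (hj : j ∈ N.support) (hij : i ≠ j) {β γ : Fin 4}
    (hβ : pauliCoeff (U i) β (N.label i) ≠ 0) (hγ : pauliCoeff (U j) γ (N.label j) ≠ 0) :
    ∃ M ∈ S'.elems, M.label i = β ∧ M.label j = γ ∧ M.support ⊆ N.support := by
  have hβ0 : β ≠ 0 := fun h =>
    PauliOp.mem_support.mp hi ((eq_zero_iff_of_pauliCoeff_ne_zero (hU i) hβ).mp h)
  have hγ0 : γ ≠ 0 := fun h =>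
    PauliOp.mem_support.mp hj ((eq_zero_iff_of_pauliCoeff_ne_zero (hU j) hγ).mp h)
  set w : ι → Fin 4 → ℂ := fun l c =>
    if l = i then (if c = β then 1 else 0) else if l = j then (if c = γ then 1 else 0)
      else pauliCoeff (U l) c (N.label l) with hw
  have hwi (m : Fin 4) : ∑ c, pauliCoeff (U i) c m * w i c = pauliCoeff (U i) β m := by
    simp [hw]
  have hwj (m : Fin 4) : ∑ c, pauliCoeff (U j) c m * w j c = pauliCoeff (U j) γ m := by
    simp [hw, hij.symm]
  have hwl {l : ι} (hli : l ≠ i) (hlj : l ≠ j) (m : Fin 4) :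
      ∑ c, pauliCoeff (U l) c m * w l c = if m = N.label l then 1 else 0 := by
    simp only [hw, if_neg hli, if_neg hlj, sum_pauliCoeff_mul (hU l)]
  have hexp : ∑ b : ι → Fin 4,
      (∑ M ∈ S.elems, M.phase * ∏ l, pauliCoeff (U l) (b l) (M.label l)) * ∏ l, w l (b l) =
        ∑ M ∈ S.elems, M.phase * ∏ l, ∑ c, pauliCoeff (U l) c (M.label l) * w l c := by
    simp only [Finset.sum_mul, Finset.prod_univ_sum, Fintype.piFinset_univ, Finset.mul_sum,
      Finset.prod_mul_distrib, mul_assoc]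
    exact Finset.sum_comm
  have hne : ∑ M ∈ S.elems, M.phase * ∏ l, ∑ c, pauliCoeff (U l) c (M.label l) * w l c ≠ 0 := by
    rw [Finset.sum_eq_single_of_mem N hN]
    · refine mul_ne_zero N.phase_ne_zero (Finset.prod_ne_zero_iff.mpr fun l _ => ?_)
      by_cases hli : l = i
      · rw [hli, hwi]
        exact hβ
      by_cases hlj : l = j
      · rw [hlj, hwj]
        exact hγ
      rw [hwl hli hlj, if_pos rfl]
      exact one_ne_zero
    · intro M hM hMN
      by_contra hterm
      have hl := fun l => Finset.prod_ne_zero_iff.mp (right_ne_zero_of_mul hterm) l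
        (Finset.mem_univ l)
      refine hMN (Stabilizer.eq_of_label_eq_off_pair hψ hent hι hN hmin hi hj hij hM ?_ ?_ ?_)
      · have := hl i
        rw [hwi] at this
        exact fun h => hβ0 ((eq_zero_iff_of_pauliCoeff_ne_zero (hU i) this).mpr h)
      · have := hl j
        rw [hwj] at this
        exact fun h => hγ0 ((eq_zero_iff_of_pauliCoeff_ne_zero (hU j) this).mpr h)
      · intro l hli hlj
        have := hl l
        rw [hwl hli hlj] at this
        by_contra h
        exact this (if_neg h)
  rw [← hexp] at hne
  obtain ⟨b, -, hb⟩ := Finset.exists_ne_zero_of_sum_ne_zero hne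
  obtain ⟨M, hM, rfl⟩ := exists_label_eq_of_sum_ne_zero hkey (left_ne_zero_of_mul hb)
  have hl := fun l => Finset.prod_ne_zero_iff.mp (right_ne_zero_of_mul hb) l (Finset.mem_univ l)
  refine ⟨M, hM, ?_, ?_, fun l hlM => ?_⟩
  · by_contra h
    exact hl i (by simp [hw, h])
  · by_contra h
    exact hl j (by simp [hw, h, hij.symm])
  · by_cases hli : l = i
    · rwa [hli]
    by_cases hlj : l = j
    · rwa [hlj]
    have := hl l
    simp only [hw, if_neg hli, if_neg hlj] at this
    rw [PauliOp.mem_support] at hlM ⊢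
    exact fun h => hlM ((eq_zero_iff_of_pauliCoeff_ne_zero (hU l) this).mpr h)

theorem mapsPauli_of_minimal (hU : ∀ i, U i ∈ Matrix.unitaryGroup (Fin 2) ℂ)
    (hkey : kron U * (∑ M ∈ S.elems, M.toMatrix) * (kron U)ᴴ = ∑ M ∈ S'.elems, M.toMatrix)
    (hψ : stabilizesState S ψ) (hent : FullyEntangled ψ)
    (hι : 2 < Fintype.card ι) (hN : N ∈ S.elems)
    (hmin : ∀ K ∈ S.elems, K.support ⊂ N.support → K.support = ∅) {i : ι}
    (hi : i ∈ N.support) : MapsPauli (U i) (N.label i) := by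
  refine mapsPauli_of_pauliCoeff (hU i) (PauliOp.mem_support.mp hi) fun β β' hβ hβ' => ?_
  have hcard : 1 < N.support.card := by
    have h1 := Stabilizer.card_support_ne_one hψ hent (by omega) hN
    have h2 := Finset.card_pos.mpr ⟨i, hi⟩
    omega
  obtain ⟨j, hj, hji⟩ := Finset.exists_mem_ne hcard i
  obtain ⟨γ, hγ⟩ := exists_pauliCoeff_ne_zero (hU j) (N.label j)
  obtain ⟨M, hM, rfl, hMj, hMω⟩ :=
    exists_mem_image_label_pair hU hkey hψ hent hι hN hmin hi hj hji.symm hβ hγ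
  obtain ⟨M', hM', rfl, hMj', hMω'⟩ :=
    exists_mem_image_label_pair hU hkey hψ hent hι hN hmin hi hj hji.symm hβ' hγ
  rw [Stabilizer.label_eq_of_minimal (minimal_image hU hkey hmin) hM hM' hMω hMω' hj
    (hMj.trans hMj'.symm)]

end LocalUnitaryImage

section CliffordReplacement

variable {ι : Type} [Fintype ι] [DecidableEq ι] {S S' : Stabilizer ι} {M N : PauliOp ι}
  {ω : Finset ι}

theorem Stabilizer.exists_label_eq_of_Aomega_eq_three (hω : IsMinimalSupport S ω)
    (hA : Aomega S ω = 3) :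
    ∃ i ∈ ω, ∀ a, a ≠ 0 → ∃ N ∈ S.elems, N.support = ω ∧ N.label i = a := by
  have hne : ω.Nonempty := by
    rw [Finset.nonempty_iff_ne_empty]
    rintro rfl
    have : Aomega S ∅ ≤ 1 := Finset.card_le_one.mpr fun M hM N hN => by
      rw [Finset.mem_filter] at hM hN
      refine eq_of_label_eq hM.1 hN.1 (funext fun i => ?_)
      rw [PauliOp.label_eq_zero hM.2.subset (Finset.notMem_empty i),
        PauliOp.label_eq_zero hN.2.subset (Finset.notMem_empty i)]
    omega
  obtain ⟨i, hi⟩ := hne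
  have himage : (S.elems.filter fun M => M.support = ω).image (fun M => M.label i) =
      Finset.univ.erase 0 := by
    refine Finset.eq_of_subset_of_card_le (fun a ha => ?_) ?_
    · obtain ⟨M, hM, rfl⟩ := Finset.mem_image.mp ha
      rw [Finset.mem_filter] at hM
      rw [← hM.2, PauliOp.mem_support] at hi
      exact Finset.mem_erase.mpr ⟨hi, Finset.mem_univ _⟩
    · rw [Finset.card_image_of_injOn]
      · exact hA.ge
      · intro M hM N hN hMN
        rw [Finset.mem_coe, Finset.mem_filter] at hM hN
        exact eq_of_label_eq hM.1 hN.1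
          (label_eq_of_minimal hω.2 hM.1 hN.1 hM.2.subset hN.2.subset hi hMN)
  refine ⟨i, hi, fun a ha => ?_⟩
  have ha' : a ∈ Finset.univ.erase (0 : Fin 4) := Finset.mem_erase.mpr ⟨ha, Finset.mem_univ a⟩
  rw [← himage] at ha'
  obtain ⟨N, hN, hNa⟩ := Finset.mem_image.mp ha'
  rw [Finset.mem_filter] at hN
  exact ⟨N, hN.1, hN.2, hNa⟩

variable {U V : ι → Matrix (Fin 2) (Fin 2) ℂ} {ψ : (ι → Fin 2) → ℂ}

theorem Stabilizer.kron_conj_eq_of_minimal (hU : ∀ i, U i ∈ Matrix.unitaryGroup (Fin 2) ℂ)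
    (hV : ∀ i, V i ∈ Matrix.unitaryGroup (Fin 2) ℂ)
    (hmin : ∀ M ∈ S.elems, IsMinimalSupport S M.support → ∀ i ∈ M.support,
      V i * pauliMat (M.label i) * (V i)ᴴ = U i * pauliMat (M.label i) * (U i)ᴴ)
    (hcond : ∀ M ∈ S.elems, ¬ IsMinimalSupport S M.support →
      ∃ ω, IsMinimalSupport S ω ∧ ω ⊂ M.support ∧ Aomega S ω = 3) (hM : M ∈ S.elems) :
    kron V * M.toMatrix * (kron V)ᴴ = kron U * M.toMatrix * (kron U)ᴴ := by
  have minimal {N : PauliOp ι} (hN : N ∈ S.elems) (hNmin : IsMinimalSupport S N.support) :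
      kron V * N.toMatrix * (kron V)ᴴ = kron U * N.toMatrix * (kron U)ᴴ := by
    rw [kron_conj_toMatrix, kron_conj_toMatrix]
    congr 2
    funext i
    by_cases hi : i ∈ N.support
    · exact hmin N hN hNmin i hi
    · have hUi : U i * (U i)ᴴ = 1 := Matrix.mem_unitaryGroup_iff.mp (hU i)
      have hVi : V i * (V i)ᴴ = 1 := Matrix.mem_unitaryGroup_iff.mp (hV i)
      rw [PauliOp.label_eq_zero subset_rfl hi, pauliMat_zero, mul_one, mul_one, hUi, hVi]
  induction hk : M.support.card using Nat.strong_induction_on generalizing M with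
  | _ k ih =>
    by_cases hMmin : IsMinimalSupport S M.support
    · exact minimal hM hMmin
    obtain ⟨ω, hω, hωM, hA⟩ := hcond M hM hMmin
    obtain ⟨i, hi, hlabel⟩ := exists_label_eq_of_Aomega_eq_three hω hA
    obtain ⟨N, hN, rfl, hNi⟩ := hlabel (M.label i) (PauliOp.mem_support.mp (hωM.subset hi))
    obtain ⟨K, hK, hKe, hKl⟩ := exists_mul hM hN
    have hKM : K.support ⊂ M.support := by
      refine (Finset.ssubset_iff_of_subset fun l hl => ?_).mpr ⟨i, hωM.subset hi, ?_⟩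
      · by_contra hlM
        refine PauliOp.mem_support.mp hl ?_
        rw [hKl, pauliLabelMul_eq_zero, PauliOp.label_eq_zero subset_rfl hlM,
          PauliOp.label_eq_zero hωM.subset hlM]
      · rw [PauliOp.mem_support, not_not, hKl, pauliLabelMul_eq_zero, hNi]
    have hMe : M.toMatrix = K.toMatrix * N.toMatrix := by
      rw [hKe, mul_assoc, toMatrix_mul_self hN, mul_one]
    rw [hMe, unitaryConj_mul (conjTranspose_kron_mul_self hU),
      unitaryConj_mul (conjTranspose_kron_mul_self hV), minimal hN hω,
      ih _ (hk ▸ Finset.card_lt_card hKM) hK rfl]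

theorem exists_isClifford_kron_conj_eq (hU : ∀ i, U i ∈ Matrix.unitaryGroup (Fin 2) ℂ)
    (hkey : kron U * (∑ M ∈ S.elems, M.toMatrix) * (kron U)ᴴ = ∑ M ∈ S'.elems, M.toMatrix)
    (hψ : stabilizesState S ψ) (hent : FullyEntangled ψ) (hι : 2 < Fintype.card ι)
    (hcond : ∀ M ∈ S.elems, ¬ IsMinimalSupport S M.support →
      ∃ ω, IsMinimalSupport S ω ∧ ω ⊂ M.support ∧ Aomega S ω = 3) :
    ∃ V : ι → Matrix (Fin 2) (Fin 2) ℂ, (∀ i, IsClifford (V i)) ∧ ∀ M ∈ S.elems,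
      kron V * M.toMatrix * (kron V)ᴴ = kron U * M.toMatrix * (kron U)ᴴ := by
  choose V hV hVU using fun i => exists_isClifford_conj_eq_of_mapsPauli (hU i)
  exact ⟨V, hV, fun M hM => Stabilizer.kron_conj_eq_of_minimal hU (fun i => (hV i).1)
    (fun N hN hNmin i hi => hVU i _ (PauliOp.mem_support.mp hi)
      (mapsPauli_of_minimal hU hkey hψ hent hι hN hNmin.2 hi)) hcond hM⟩

theorem mul_vecMulVec_star_conj {κ : Type} [Fintype κ] (A : Matrix κ κ ℂ) (v : κ → ℂ) :
    A * vecMulVec v (star v) * Aᴴ = vecMulVec (A *ᵥ v) (star (A *ᵥ v)) := by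
  rw [Matrix.mul_vecMulVec, Matrix.vecMulVec_mul, Matrix.star_mulVec]

theorem exists_smul_eq_of_vecMulVec_eq {κ : Type} [Fintype κ] {v w : κ → ℂ}
    (hv : star v ⬝ᵥ v = 1) (hw : star w ⬝ᵥ w = 1)
    (h : vecMulVec v (star v) = vecMulVec w (star w)) :
    ∃ c : ℂ, star c * c = 1 ∧ c • v = w := by
  have key : (star v ⬝ᵥ w) • v = w := by
    have := congrArg (fun X => X *ᵥ w) h
    simpa [Matrix.vecMulVec_mulVec, hw] using this
  refine ⟨star v ⬝ᵥ w, ?_, key⟩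
  have := hw
  rw [← key] at this
  rw [mul_comm]
  simpa only [star_smul, smul_dotProduct, dotProduct_smul, hv, smul_eq_mul, mul_one] using this

theorem IsClifford.smul {W : Matrix (Fin 2) (Fin 2) ℂ} (hW : IsClifford W) {c : ℂ}
    (hc : star c * c = 1) : IsClifford (c • W) := by
  obtain ⟨hWu, π, hπ⟩ := hW
  refine ⟨?_, π, fun u => ?_⟩
  · rw [Matrix.mem_unitaryGroup_iff', Matrix.star_eq_conjTranspose] at hWu ⊢
    rw [Matrix.conjTranspose_smul, smul_mul_smul_comm, hc, hWu, one_smul]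
  · obtain ⟨s, hs, h⟩ := hπ u
    refine ⟨s, hs, ?_⟩
    rw [Matrix.conjTranspose_smul, Matrix.smul_mul, smul_mul_smul_comm, mul_comm c, hc, one_smul,
      h]

theorem LCequiv.luEquiv {φ : (ι → Fin 2) → ℂ} (h : LCequiv ψ φ) : LUequiv ψ φ :=
  let ⟨V, hV, hVφ⟩ := h
  ⟨V, fun i => (hV i).1, hVφ⟩

theorem LCequiv.of_smul {φ : (ι → Fin 2) → ℂ} [Nonempty ι] {c : ℂ} (hc : star c * c = 1)
    (hV : ∀ i, IsClifford (V i)) (h : c • (kron V *ᵥ ψ) = φ) : LCequiv ψ φ := by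
  let i₀ : ι := Classical.arbitrary ι
  refine ⟨fun i => (if i = i₀ then c else 1) • V i, fun i => ?_, ?_⟩
  · by_cases hi : i = i₀
    · simpa [hi] using (hV i₀).smul hc
    · simpa [hi] using hV i
  · rw [kron_smul, Finset.prod_ite_eq' Finset.univ i₀ fun _ => c, if_pos (Finset.mem_univ _),
      Matrix.smul_mulVec, h]

theorem star_mulVec_dotProduct_mulVec {κ : Type} [Fintype κ] [DecidableEq κ] {A : Matrix κ κ ℂ}
    (hA : Aᴴ * A = 1) (v : κ → ℂ) : star (A *ᵥ v) ⬝ᵥ (A *ᵥ v) = star v ⬝ᵥ v := by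
  rw [Matrix.star_mulVec, Matrix.dotProduct_mulVec, Matrix.vecMul_vecMul, hA, Matrix.vecMul_one]

theorem LUequiv.lcEquiv {φ : (ι → Fin 2) → ℂ} (hψ : stabilizesState S ψ)
    (hent : FullyEntangled ψ) (hι : 2 < Fintype.card ι)
    (hcond : ∀ M ∈ S.elems, ¬ IsMinimalSupport S M.support →
      ∃ ω, IsMinimalSupport S ω ∧ ω ⊂ M.support ∧ Aomega S ω = 3)
    (hφ : IsStabilizerState φ) (h : LUequiv ψ φ) : LCequiv ψ φ := by
  obtain ⟨S', hS'⟩ := hφ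
  obtain ⟨U, hU, rfl⟩ := h
  have hconj (A : Matrix (ι → Fin 2) (ι → Fin 2) ℂ) :
      A * (∑ M ∈ S.elems, M.toMatrix) * Aᴴ =
        (2 ^ Fintype.card ι : ℂ) • vecMulVec (A *ᵥ ψ) (star (A *ᵥ ψ)) := by
    rw [sum_toMatrix_eq_vecMulVec hψ, Matrix.mul_smul, Matrix.smul_mul, mul_vecMulVec_star_conj]
  have hkey : kron U * (∑ M ∈ S.elems, M.toMatrix) * (kron U)ᴴ = ∑ M ∈ S'.elems, M.toMatrix := by
    rw [hconj, sum_toMatrix_eq_vecMulVec hS']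
  obtain ⟨V, hV, hVU⟩ := exists_isClifford_kron_conj_eq hU hkey hψ hent hι hcond
  have heq : vecMulVec (kron V *ᵥ ψ) (star (kron V *ᵥ ψ)) =
      vecMulVec (kron U *ᵥ ψ) (star (kron U *ᵥ ψ)) := by
    refine smul_right_injective _ (pow_ne_zero (Fintype.card ι) (two_ne_zero (α := ℂ))) ?_
    simp only
    rw [← hconj, ← hconj]
    simp only [Finset.mul_sum, Finset.sum_mul]
    exact Finset.sum_congr rfl hVU
  have hψ1 := star_dotProduct_self_eq_one hψ.1
  obtain ⟨c, hc, hcV⟩ := exists_smul_eq_of_vecMulVec_eq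
    ((star_mulVec_dotProduct_mulVec (conjTranspose_kron_mul_self fun i => (hV i).1) ψ).trans hψ1)
    (star_dotProduct_self_eq_one hS'.1) heq
  have : Nonempty ι := Fintype.card_pos_iff.mp (by omega)
  exact LCequiv.of_smul hc hV hcV

end CliffordReplacement

/-- Let `ψ` be a fully entangled stabilizer state on `n ≥ 3` qubits such
that for every stabilizer element whose support is not minimal there is a minimal support
`ω'` strictly contained in its support with `A_{ω'}(ψ) = 3`. Then `LU(ψ) = LC(ψ)`. -/
theorem stmt_5 {n : ℕ} (hn : 3 ≤ n) (S : Stabilizer (Fin n)) (ψ : (Fin n → Fin 2) → ℂ)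
    (hψ : stabilizesState S ψ) (hent : FullyEntangled ψ)
    (hcond : ∀ M ∈ S.elems, ¬ IsMinimalSupport S (PauliOp.support M) →
      ∃ ω' : Finset (Fin n),
        IsMinimalSupport S ω' ∧ ω' ⊂ PauliOp.support M ∧ Aomega S ω' = 3) :
    ∀ φ : (Fin n → Fin 2) → ℂ, IsStabilizerState φ → (LUequiv ψ φ ↔ LCequiv ψ φ) :=
  fun φ hφ => ⟨LUequiv.lcEquiv hψ hent (by rwa [Fintype.card_fin]) hcond hφ,
    LCequiv.luEquiv⟩
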